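/- (Uniqueness of the SJ positive part.) Let A be a bounded self-adjoint operator on a complex Hilbert space H and Γ a conjugation with Γ A Γ = −A. If B is a bounded positive operator satisfying B − Γ B Γ = A and B · (Γ B Γ) = 0, then B = (A + √(A²))/2. -/

import Mathlib

open scoped ComplexOrder

local notation "⟪" x ", " y "⟫" => @inner ℂ _ _ x y

/-- Uniqueness of the SJ positive part: with `Γ` a conjugation, `A` bounded
self-adjoint satisfying `Γ A Γ = -A`, and `R = √(A²)` the positive square root of
`A²`, any bounded positive operator `B` with `B - Γ B Γ = A` and `B (Γ B Γ) = 0`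
equals `A₊ = (A + R)/2`. -/
theorem sj_positive_part_unique {H : Type*} [NormedAddCommGroup H] [InnerProductSpace ℂ H]
    [CompleteSpace H] (Γ : H → H)
    (hΓadd : ∀ x y : H, Γ (x + y) = Γ x + Γ y)
    (hΓsmul : ∀ (c : ℂ) (x : H), Γ (c • x) = (starRingEnd ℂ) c • Γ x)
    (hΓinv : ∀ x : H, Γ (Γ x) = x)
    (hΓip : ∀ x y : H, ⟪Γ x, Γ y⟫ = ⟪y, x⟫)
    (A R B : H →L[ℂ] H)
    (hA : IsSelfAdjoint A)
    (hΓA : ∀ x : H, Γ (A (Γ x)) = -(A x))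
    (hR : IsSelfAdjoint R) (hRpos : ∀ ψ : H, 0 ≤ ⟪ψ, R ψ⟫)
    (hsq : R * R = A * A)
    (hBpos : ∀ ψ : H, 0 ≤ ⟪ψ, B ψ⟫)
    (hB1 : ∀ x : H, B x - Γ (B (Γ x)) = A x)
    (hB2 : ∀ x : H, B (Γ (B (Γ x))) = 0) :
    B = (1/2 : ℂ) • (A + R) := by
  have key : ∀ T : H →L[ℂ] H, (∀ ψ : H, 0 ≤ ⟪ψ, T ψ⟫) → 0 ≤ T := by
    intro T hT
    rw [ContinuousLinearMap.nonneg_iff_isPositive, ContinuousLinearMap.isPositive_iff_complex]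
    intro x
    have h := hT x
    rw [← inner_conj_symm] at h
    have h2 : 0 ≤ ⟪T x, x⟫ := by
      have := star_nonneg_iff.mpr h
      simpa using this
    obtain ⟨h3, h4⟩ := Complex.nonneg_iff.mp h2
    refine ⟨?_, h3⟩
    apply Complex.ext
    · simp
    · simpa using h4
  have hCx : ∀ x, (B - A) x = Γ (B (Γ x)) := by
    intro x
    rw [ContinuousLinearMap.sub_apply, ← hB1 x]
    abel
  have hB0 : 0 ≤ B := key B hBpos
  have hC0 : 0 ≤ B - A := by
    apply key
    intro x
    have h := hΓip (Γ x) (B (Γ x))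
    rw [hΓinv] at h
    rw [hCx, h, ← inner_conj_symm]
    have := star_nonneg_iff.mpr (hBpos (Γ x))
    simpa using this
  have hR0 : 0 ≤ R := key R hRpos
  have hBC : B * (B - A) = 0 := by
    ext x
    rw [ContinuousLinearMap.mul_apply, hCx, hB2]
    simp
  have hCB : (B - A) * B = 0 := by
    have h := congrArg star hBC
    rwa [star_mul, (IsSelfAdjoint.of_nonneg hB0).star_eq,
      (IsSelfAdjoint.of_nonneg hC0).star_eq, star_zero] at h
  have hS : (B + (B - A)) * (B + (B - A)) = A * A := by
    have h : (B + (B - A)) * (B + (B - A)) =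
        A * A + (B * (B - A) + B * (B - A)) + ((B - A) * B + (B - A) * B) := by
      noncomm_ring
    rw [h, hBC, hCB]
    simp
  have e1 := CFC.sqrt_unique hS (add_nonneg hB0 hC0)
  have e2 := CFC.sqrt_unique hsq hR0
  have e : R = B + (B - A) := e2.symm.trans e1
  rw [e]
  module
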